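/- Let A be an n × n matrix over ℂ, n ≥ 1, and let λ be an eigenvalue of A whose geometric multiplicity k equals its algebraic multiplicity, with 1 ≤ k ≤ n − 1. Let v₁, …, v_k be a basis of ker(A − λI) and let w₁, …, w_k ∈ ker((A − λI)ᵀ) satisfy wᵢᵀ vⱼ = δᵢⱼ for i, j = 1, …, k. Set v = v₁ ∧ ⋯ ∧ v_k and w = w₁ ∧ ⋯ ∧ w_k, regarded as vectors in ℂ^C(n,k) via Plücker coordinates. Then ((−1)^k P⁽ᵏ⁾(λ) / k!) · v wᵀ = adj_k(A − λI), where P(t) = det(A − tI) is the characteristic polynomial of A and P⁽ᵏ⁾ is its k-th derivative. -/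

import Mathlib

open Matrix

variable {K : Type*}

/-- The `k`-th compound matrix of an `m × n` matrix `A`: it is indexed by the
`k`-element subsets of the row/column index sets (which correspond to `Fin (choose _ k)`
via the lexicographic order), and its `(S, T)` entry is the `k × k` minor of `A`
on rows `S` and columns `T`. -/
def compound [CommRing K] {m n : ℕ} (k : ℕ) (A : Matrix (Fin m) (Fin n) K) :
    Matrix {s : Finset (Fin m) // s.card = k} {t : Finset (Fin n) // t.card = k} K :=
  fun S T => (A.submatrix (S.1.orderEmbOfFin S.2) (T.1.orderEmbOfFin T.2)).det

/-- The `k`-th adjugate of an `n × n` matrix `A` (generalizing the classical adjugate,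
which is the case `k = 1`): its `(S, T)` entry is `(-1) ^ (Σ S + Σ T)` times the
`(n-k) × (n-k)` minor of `A` obtained by deleting the rows indexed by `T` and the
columns indexed by `S`.  (The sums `Σ S`, `Σ T` are taken with 1-based indexing in the
classical formula; with 0-based indexing the parity is unchanged.) -/
def adjCompound [CommRing K] {n : ℕ} (k : ℕ) (A : Matrix (Fin n) (Fin n) K) :
    Matrix {s : Finset (Fin n) // s.card = k} {t : Finset (Fin n) // t.card = k} K :=
  fun S T =>
    (-1 : K) ^ ((∑ i ∈ S.1, (i : ℕ)) + (∑ j ∈ T.1, (j : ℕ))) *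
      (A.submatrix
        ((T.1ᶜ).orderEmbOfFin (show (T.1ᶜ).card = n - k by
          simp [Finset.card_compl, T.2]))
        ((S.1ᶜ).orderEmbOfFin (show (S.1ᶜ).card = n - k by
          simp [Finset.card_compl, S.2]))).det

/-- The Plücker coordinates of `x₁ ∧ ⋯ ∧ x_k ∈ ℂ^(choose n k)`: the coordinate at the
`k`-element subset `S` is the `k × k` minor of the `n × k` matrix `[x₁ ⋯ x_k]` on rows `S`. -/
def wedgeVec [CommRing K] {n k : ℕ} (x : Fin k → Fin n → K) :
    {s : Finset (Fin n) // s.card = k} → K :=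
  fun S => (Matrix.of fun (i j : Fin k) => x j (S.1.orderEmbOfFin S.2 i)).det

/-- The characteristic polynomial `P(t) = det (A - t I)`. -/
noncomputable def detPoly [CommRing K] {n : ℕ} (A : Matrix (Fin n) (Fin n) K) : Polynomial K :=
  ((Matrix.of fun i j => Polynomial.C (A i j)) - (Polynomial.X : Polynomial K) • 1).det

/-- If the columns of `V` lie in the kernel of `B`, the rows of `W` in its left kernel, and
`W * V = 1`, then every minor of `B` of complementary size factors through the corresponding
maximal minors of `V` and `W` and the determinant of `B + V * W`. -/
theorem det_submatrix_inr_of_mul_eq_zero {R ι m p : Type*} [CommRing R]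
    [Fintype ι] [DecidableEq ι] [Fintype m] [DecidableEq m] [Fintype p] [DecidableEq p]
    {B : Matrix ι ι R} {V : Matrix ι m R} {W : Matrix m ι R}
    (hV : B * V = 0) (hW : W * B = 0) (hWV : W * V = 1) (e f : m ⊕ p ≃ ι) :
    (W.submatrix id (e ∘ Sum.inl)).det * ((B + V * W).submatrix e f).det *
        (V.submatrix (f ∘ Sum.inl) id).det =
      (B.submatrix (e ∘ Sum.inr) (f ∘ Sum.inr)).det := by
  set G := B + V * W with hG
  have hWG : W * G = W := by
    rw [hG, Matrix.mul_add, hW, ← Matrix.mul_assoc, hWV, Matrix.one_mul, zero_add]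
  have hGV : G * V = V := by
    rw [hG, Matrix.add_mul, hV, Matrix.mul_assoc, hWV, Matrix.mul_one, zero_add]
  have hL : fromBlocks (W.submatrix id (e ∘ Sum.inl)) (W.submatrix id (e ∘ Sum.inr)) 0 1 *
      G.submatrix e f =
      fromBlocks (W.submatrix id (f ∘ Sum.inl)) (W.submatrix id (f ∘ Sum.inr))
        (G.submatrix (e ∘ Sum.inr) (f ∘ Sum.inl)) (G.submatrix (e ∘ Sum.inr) (f ∘ Sum.inr)) := by
    have key (i : m) (j : ι) :
        ∑ a, W i (e (Sum.inl a)) * G (e (Sum.inl a)) j +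
          ∑ b, W i (e (Sum.inr b)) * G (e (Sum.inr b)) j = W i j := by
      rw [← Fintype.sum_sum_type (fun x => W i (e x) * G (e x) j),
        e.sum_comp (fun x => W i x * G x j), ← mul_apply, hWG]
    ext (i | i) (j | j) <;> simp [mul_apply, key, one_apply]
  have hU : fromBlocks (W.submatrix id (f ∘ Sum.inl)) (W.submatrix id (f ∘ Sum.inr))
        (G.submatrix (e ∘ Sum.inr) (f ∘ Sum.inl)) (G.submatrix (e ∘ Sum.inr) (f ∘ Sum.inr)) *
      fromBlocks (V.submatrix (f ∘ Sum.inl) id) 0 (V.submatrix (f ∘ Sum.inr) id) 1 =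
      fromBlocks 1 (W.submatrix id (f ∘ Sum.inr)) (V.submatrix (e ∘ Sum.inr) id)
        (G.submatrix (e ∘ Sum.inr) (f ∘ Sum.inr)) := by
    have key (r : ι → R) (j : m) :
        ∑ a, r (f (Sum.inl a)) * V (f (Sum.inl a)) j +
          ∑ b, r (f (Sum.inr b)) * V (f (Sum.inr b)) j = ∑ x, r x * V x j := by
      rw [← Fintype.sum_sum_type (fun x => r (f x) * V (f x) j),
        f.sum_comp (fun x => r x * V x j)]
    have keyW (i : m) (j : m) := key (W i) j
    have keyG (i : ι) (j : m) := key (G i) j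
    simp only [← mul_apply, hWV] at keyW
    simp only [← mul_apply, hGV] at keyG
    rw [fromBlocks_multiply]
    congr 1
    · ext i j; simpa [mul_apply] using keyW i j
    · simp
    · ext i j; simpa [mul_apply] using keyG (e (Sum.inr i)) j
    · simp
  have h := congrArg det hU
  rw [← hL, det_mul, det_mul, det_fromBlocks_zero₂₁, det_fromBlocks_zero₁₂, det_one, mul_one,
    mul_one, det_fromBlocks_one₁₁] at h
  rw [h]
  congr 1
  ext i j
  simp [hG, mul_apply]

theorem det_add_mul_sub_smul {ι m : Type*} [Fintype ι] [DecidableEq ι] [Fintype m]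
    [DecidableEq m] {F : Type*} [Field F] {B : Matrix ι ι F} {V : Matrix ι m F} {W : Matrix m ι F}
    (hV : B * V = 0) (hWV : W * V = 1) {s : F} (hs : s ≠ 0) :
    s ^ Fintype.card m * (B + V * W - s • 1).det =
      (s - 1) ^ Fintype.card m * (B - s • 1).det := by
  have h : B + V * W - s • 1 = (B - s • 1) * (1 - V * (s⁻¹ • W)) := by
    simp [Matrix.mul_sub, Matrix.sub_mul, ← Matrix.mul_assoc, hV, hs]
    abel
  have h' : (1 : Matrix m m F) - s⁻¹ • W * V = (1 - s⁻¹) • 1 := by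
    rw [Matrix.smul_mul, hWV, sub_smul, one_smul]
  rw [h, det_mul, det_one_sub_mul_comm, h', det_smul, det_one, mul_one, mul_comm (det _),
    ← mul_assoc, ← mul_pow]
  congr 2
  field_simp

open Finset in
theorem finSumEquivOfFinset_map_swap {n k l : ℕ} {S : Finset (Fin n)} (hS : S.card = k)
    (hS' : Sᶜ.card = l) {a b : Fin n} (hab : (b : ℕ) = a + 1) (ha : a ∉ S) (hb : b ∈ S)
    {T : Finset (Fin n)} (hT : T.card = k) (hT' : Tᶜ.card = l)
    (hST : T = S.map (Equiv.swap a b).toEmbedding) :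
    finSumEquivOfFinset hT hT' = (finSumEquivOfFinset hS hS').trans (Equiv.swap a b) := by
  have mono {U : Finset (Fin n)} {j : ℕ} (hU : U.card = j) (h : ¬ (a ∈ U ∧ b ∈ U)) :
      StrictMono fun i => Equiv.swap a b (U.orderEmbOfFin hU i) := by
    have aux (p q : Fin n) (hp : p ∈ U) (hq : q ∈ U) (hpq : p < q) :
        Equiv.swap a b p < Equiv.swap a b q := by
      simp only [Equiv.swap_apply_def]
      grind
    exact fun x y hxy => aux _ _ (U.orderEmbOfFin_mem hU x) (U.orderEmbOfFin_mem hU y)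
      ((U.orderEmbOfFin hU).strictMono hxy)
  ext1 (x | x)
  · simp only [Equiv.trans_apply, finSumEquivOfFinset_inl]
    refine (congrFun (orderEmbOfFin_unique hT (fun x => ?_) (mono hS (by tauto))) x).symm
    simp [hST]
  · simp only [Equiv.trans_apply, finSumEquivOfFinset_inr]
    refine (congrFun (orderEmbOfFin_unique hT' (fun x => ?_) (mono hS' (by simp [hb]))) x).symm
    have := Sᶜ.orderEmbOfFin_mem hS' x
    rw [mem_compl] at this ⊢
    simpa [hST] using this

open Finset in
theorem eq_filter_lt_card_of_pred_mem {n : ℕ} {S : Finset (Fin n)}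
    (h : ∀ a b : Fin n, (b : ℕ) = a + 1 → b ∈ S → a ∈ S) :
    S = univ.filter fun i : Fin n => (i : ℕ) < S.card := by
  have lower (d : ℕ) : ∀ a b : Fin n, (b : ℕ) = a + d → b ∈ S → a ∈ S := by
    induction d with
    | zero => intro a b hab hb; rwa [show a = b from Fin.ext hab.symm]
    | succ d ih =>
      intro a b hab hb
      exact h a ⟨a + 1, by omega⟩ rfl (ih _ b (by simp; omega) hb)
  refine eq_of_subset_of_card_le (fun b hb => ?_) ?_
  · have : Iic b ⊆ S := fun a ha => lower (b - a) a b (by have := mem_Iic.1 ha; omega) hb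
    have := card_le_card this
    rw [Fin.card_Iic] at this
    simp; omega
  · rw [Fin.card_filter_val_lt]
    exact min_le_right _ _

open Finset in
/-- The sign of the permutation listing `S` in increasing order, followed by its complement. -/
theorem sign_finSumEquivOfFinset {n k l : ℕ} (g : Fin k ⊕ Fin l ≃ Fin n)
    (hg : ∀ x, (g x : ℕ) = finSumFinEquiv x) (S : Finset (Fin n)) (hS : S.card = k)
    (hS' : Sᶜ.card = l) :
    Equiv.Perm.sign (g.symm.trans (finSumEquivOfFinset hS hS')) =
      (-1) ^ (∑ i ∈ S, (i : ℕ) + ∑ i ∈ univ.filter (fun i : Fin n => (i : ℕ) < k), (i : ℕ)) := by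
  induction h : ∑ i ∈ S, (i : ℕ) using Nat.strong_induction_on generalizing S with
  | _ N ih =>
  by_cases hdown : ∀ a b : Fin n, (b : ℕ) = a + 1 → b ∈ S → a ∈ S
  · have hfil := eq_filter_lt_card_of_pred_mem hdown
    rw [hS] at hfil
    have : finSumEquivOfFinset hS hS' = g := by
      ext1 (x | x)
      · rw [finSumEquivOfFinset_inl]
        refine (congrFun (orderEmbOfFin_unique hS (f := g ∘ Sum.inl) (fun x => ?_) ?_) x).symm
        · rw [hfil]; simp [hg]
        · intro x y hxy; rw [Fin.lt_def] at hxy ⊢; simpa [hg] using hxy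
      · rw [finSumEquivOfFinset_inr]
        refine (congrFun (orderEmbOfFin_unique hS' (f := g ∘ Sum.inr) (fun x => ?_) ?_) x).symm
        · rw [mem_compl, hfil]; simp [hg]
        · intro x y hxy; rw [Fin.lt_def] at hxy ⊢; simpa [hg] using hxy
    rw [this, ← h, ← hfil, ← two_mul, pow_mul]
    simp
  · push Not at hdown
    obtain ⟨a, b, hab, hb, ha⟩ := hdown
    set T := S.map (Equiv.swap a b).toEmbedding with hT
    have hTk : T.card = k := by simp [hT, hS]
    have hTl : Tᶜ.card = l := by rw [card_compl, hTk, ← hS, ← card_compl, hS']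
    have hne : a ≠ b := by grind
    have hsum : ∑ i ∈ T, (i : ℕ) + 1 = N := by
      rw [← h, hT, sum_map, ← add_sum_erase S _ hb, ← add_sum_erase S _ hb]
      rw [sum_congr rfl (g := fun i : Fin n => (i : ℕ))]
      · simp; omega
      · intro i hi
        have := mem_erase.1 hi
        simp [Equiv.swap_apply_of_ne_of_ne (show i ≠ a by grind) this.1]
    have := ih _ (by omega) T hTk hTl rfl
    rw [finSumEquivOfFinset_map_swap hS hS' hab ha hb hTk hTl hT, ← Equiv.trans_assoc,
      Equiv.Perm.sign_trans, Equiv.Perm.sign_swap hne] at this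
    rw [← hsum, add_right_comm, pow_succ, ← this]
    simp

open Finset in
theorem det_submatrix_finSumEquivOfFinset {R : Type*} [CommRing R] {n k l : ℕ}
    {S T : Finset (Fin n)} (hS : S.card = k) (hS' : Sᶜ.card = l) (hT : T.card = k)
    (hT' : Tᶜ.card = l) (M : Matrix (Fin n) (Fin n) R) :
    (M.submatrix (finSumEquivOfFinset hT hT') (finSumEquivOfFinset hS hS')).det =
      (-1) ^ (∑ i ∈ S, (i : ℕ) + ∑ i ∈ T, (i : ℕ)) * M.det := by
  have hn : k + l = n := by
    rw [← hS, ← hS', card_compl, Fintype.card_fin]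
    have := card_le_univ S
    rw [Fintype.card_fin] at this
    omega
  subst hn
  have hg := sign_finSumEquivOfFinset (k := k) (l := l) finSumFinEquiv (fun _ => rfl)
  set g : Fin k ⊕ Fin l ≃ Fin (k + l) := finSumFinEquiv
  set σ := g.symm.trans (finSumEquivOfFinset hS hS') with hσ
  set τ := g.symm.trans (finSumEquivOfFinset hT hT') with hτ
  have : M.submatrix (finSumEquivOfFinset hT hT') (finSumEquivOfFinset hS hS') =
      ((M.submatrix τ id).submatrix id σ).submatrix g g := by
    ext i j
    simp [hσ, hτ]
  rw [this, det_submatrix_equiv_self, det_permute', det_permute, hg S hS hS', hg T hT hT',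
    ← mul_assoc]
  push_cast
  rw [← pow_add]
  congr 1
  rw [neg_one_pow_congr]
  simp only [Nat.even_add]
  tauto

theorem eval_detPoly {R : Type*} [CommRing R] {n : ℕ} (A : Matrix (Fin n) (Fin n) R) (t : R) :
    (detPoly A).eval t = (A - t • 1).det := by
  rw [detPoly, ← Polynomial.coe_evalRingHom, RingHom.map_det]
  congr 1
  ext i j
  by_cases h : i = j <;> simp [h, one_apply]

theorem det_add_mul_eq_iterate_derivative_detPoly {n k : ℕ} {A : Matrix (Fin n) (Fin n) ℂ}
    {lam : ℂ} (halg : (detPoly A).rootMultiplicity lam = k) {V : Matrix (Fin n) (Fin k) ℂ}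
    {W : Matrix (Fin k) (Fin n) ℂ} (hV : (A - lam • 1) * V = 0) (hWV : W * V = 1) :
    (A - lam • 1 + V * W).det =
      (-1) ^ k * (Polynomial.derivative^[k] (detPoly A)).eval lam / (Nat.factorial k : ℂ) := by
  have hder := Polynomial.eval_iterate_derivative_rootMultiplicity (p := detPoly A) (t := lam)
  have hfac := (detPoly A).pow_mul_divByMonic_rootMultiplicity_eq lam
  rw [halg] at hder hfac
  set Q := detPoly A /ₘ (Polynomial.X - Polynomial.C lam) ^ k
  have hpunct : Set.EqOn (fun s : ℂ => (A - lam • 1 + V * W - s • 1).det)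
      (fun s => (s - 1) ^ k * Q.eval (lam + s)) {0}ᶜ := by
    intro s hs
    have h := det_add_mul_sub_smul hV hWV hs
    have hP := congrArg (Polynomial.eval (lam + s)) hfac
    rw [eval_detPoly, add_smul, ← sub_sub] at hP
    simp only [Polynomial.eval_mul, Polynomial.eval_pow, Polynomial.eval_sub, Polynomial.eval_X,
      Polynomial.eval_C, add_sub_cancel_left] at hP
    rw [Fintype.card_fin, ← hP] at h
    exact mul_left_cancel₀ (pow_ne_zero k hs) (h.trans (by ring))
  have hcont := Continuous.ext_on (dense_compl_singleton (0 : ℂ)) (by fun_prop) (by fun_prop) hpunct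
  have h0 := congrFun hcont 0
  simp only [zero_smul, sub_zero, zero_sub, add_zero] at h0
  rw [h0, hder, nsmul_eq_mul]
  field_simp [Nat.factorial_ne_zero k]

/-- **Eigenvectors-from-eigenvalues identity** (general version).
Let `A` be an `n × n` complex matrix, `n ≥ 1`, and `λ` an eigenvalue whose geometric
multiplicity `k` equals its algebraic multiplicity, `1 ≤ k ≤ n - 1`.  If `v₁, …, v_k` is a
basis of `ker (A - λI)` and `w₁, …, w_k ∈ ker (A - λI)ᵀ` satisfy `wᵢᵀ vⱼ = δᵢⱼ`, then
`((-1)^k P⁽ᵏ⁾(λ) / k!) • (v wᵀ) = adj_k (A - λI)`, where `v = v₁ ∧ ⋯ ∧ v_k`,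
`w = w₁ ∧ ⋯ ∧ w_k` (Plücker coordinates) and `P(t) = det (A - tI)`. -/
theorem eigenvector_eigenvalue_identity
    {n : ℕ} (hn : 1 ≤ n) (A : Matrix (Fin n) (Fin n) ℂ) (lam : ℂ)
    {k : ℕ} (hk1 : 1 ≤ k) (hk2 : k ≤ n - 1)
    (hgeo : Module.finrank ℂ (LinearMap.ker (A - lam • 1).mulVecLin) = k)
    (halg : (detPoly A).rootMultiplicity lam = k)
    (v : Fin k → Fin n → ℂ)
    (hv_indep : LinearIndependent ℂ v)
    (hv_span : Submodule.span ℂ (Set.range v) = LinearMap.ker (A - lam • 1).mulVecLin)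
    (w : Fin k → Fin n → ℂ)
    (hw : ∀ i, (A - lam • 1)ᵀ *ᵥ w i = 0)
    (hwv : ∀ i j, w i ⬝ᵥ v j = if i = j then 1 else 0) :
    ((-1 : ℂ) ^ k * (Polynomial.derivative^[k] (detPoly A)).eval lam / (Nat.factorial k : ℂ)) •
        Matrix.vecMulVec (wedgeVec v) (wedgeVec w)
      = adjCompound k (A - lam • 1) := by
  set B := A - lam • 1 with hB
  have hV : B * (of v)ᵀ = 0 := by
    ext i j
    have : v j ∈ LinearMap.ker B.mulVecLin := hv_span ▸ Submodule.subset_span ⟨j, rfl⟩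
    exact congrFun (LinearMap.mem_ker.1 this) i
  have hW : of w * B = 0 := by
    ext i j
    have h := congrFun (hw i) j
    rw [mulVec_transpose] at h
    exact h
  have hWV : of w * (of v)ᵀ = 1 := by
    ext i j
    rw [one_apply]
    exact hwv i j
  have hG := det_add_mul_eq_iterate_derivative_detPoly halg hV hWV
  ext S T
  have hS' : (S.1ᶜ).card = n - k := by simp [Finset.card_compl, S.2]
  have hT' : (T.1ᶜ).card = n - k := by simp [Finset.card_compl, T.2]
  have h := det_submatrix_inr_of_mul_eq_zero hV hW hWV
    (finSumEquivOfFinset T.2 hT') (finSumEquivOfFinset S.2 hS')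
  rw [det_submatrix_finSumEquivOfFinset, hG] at h
  have hv : ((of v)ᵀ.submatrix (finSumEquivOfFinset S.2 hS' ∘ Sum.inl) id).det = wedgeVec v S :=
    congrArg det (by ext i j; simp)
  have hw : ((of w).submatrix id (finSumEquivOfFinset T.2 hT' ∘ Sum.inl)).det = wedgeVec w T := by
    rw [← det_transpose]
    exact congrArg det (by ext i j; simp)
  have hB' : B.submatrix (finSumEquivOfFinset T.2 hT' ∘ Sum.inr)
      (finSumEquivOfFinset S.2 hS' ∘ Sum.inr) =
      B.submatrix ((T.1ᶜ).orderEmbOfFin hT') ((S.1ᶜ).orderEmbOfFin hS') := by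
    ext i j; simp
  rw [hv, hw, hB'] at h
  simp only [adjCompound, ← h, Matrix.smul_apply, vecMulVec_apply, smul_eq_mul]
  have hsq : ((-1 : ℂ) ^ (∑ i ∈ S.1, (i : ℕ) + ∑ j ∈ T.1, (j : ℕ))) ^ 2 = 1 := by
    rw [← pow_mul, mul_comm, pow_mul]; simp
  linear_combination (-(wedgeVec w T * wedgeVec v S *
    ((-1 : ℂ) ^ k * (Polynomial.derivative^[k] (detPoly A)).eval lam / (Nat.factorial k : ℂ)))) * hsq
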